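/- Let τ1 : Ω × Ω → {C,D} be a deterministic memory-two strategy, set τ2(s1,s2) := τ1(π(s1), π(s2)), and suppose the pair (τ1, τ2) forms a symmetric mutual reinforcement learning equilibrium: there exist Q1, Q2 : {C,D} × Ω × Ω → ℝ such that Q1 satisfies the player-1 memory-two Bellman optimality equation against τ2 with τ1 strictly greedy for Q1, and Q2 satisfies the player-2 memory-two Bellman optimality equation against τ1 with τ2 strictly greedy for Q2. Then for every s1 ∈ {(C,D),(D,C)}, either τ1(π(s1), s2) = τ1(s1, π(s2)) for all states s2, or τ1(π(s1), s2) ≠ τ1(s1, π(s2)) for all states s2. -/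

import Mathlib

inductive Act where
  | C : Act
  | D : Act
deriving DecidableEq

open Act

abbrev St : Type := Act × Act

/-- Player 1's payoff in the prisoner's dilemma. -/
def r1 (R S T P : ℝ) : Act → Act → ℝ
  | C, C => R
  | C, D => S
  | D, C => T
  | D, D => P

/-- Swap the roles of the two players in a state. -/
def pi' (s : St) : St := (s.2, s.1)

/-- Strictly greedy play against a memory-two opponent depends on the second-to-last state only
through the opponent's action. -/
lemma greedy_eq_of_opponent_eq {R S T P γ : ℝ} {τ τ' : St → St → Act} {Q : Act → St → St → ℝ}
    (hQ : ∀ σ s1 s2, Q σ s1 s2 =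
      r1 R S T P σ (τ' s1 s2) + γ * max (Q C (σ, τ' s1 s2) s1) (Q D (σ, τ' s1 s2) s1))
    (hg : ∀ s1 s2, (τ s1 s2 = C → Q C s1 s2 > Q D s1 s2) ∧
      (τ s1 s2 = D → Q D s1 s2 > Q C s1 s2))
    {s a b : St} (h : τ' s a = τ' s b) : τ s a = τ s b := by
  have hQab (σ : Act) : Q σ s a = Q σ s b := by rw [hQ σ s a, hQ σ s b, h]
  have ha := hg s a
  have hb := hg s b
  rw [hQab, hQab] at ha
  cases hx : τ s a <;> cases hy : τ s b
  · rfl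
  · exact (lt_asymm (ha.1 hx) (hb.2 hy)).elim
  · exact (lt_asymm (ha.2 hx) (hb.1 hy)).elim
  · rfl

/-- Two action-valued functions that determine each other agree everywhere or nowhere. -/
lemma forall_eq_or_forall_ne {α : Type*} {x y : α → Act}
    (hxy : ∀ a b, x a = x b → y a = y b) (hyx : ∀ a b, y a = y b → x a = x b) :
    (∀ a, y a = x a) ∨ (∀ a, y a ≠ x a) := by
  by_contra! ⟨⟨a, ha⟩, b, hb⟩
  have h₁ := hxy a b
  have h₂ := hyx a b
  cases hxa : x a <;> cases hxb : x b <;> cases hya : y a <;> cases hyb : y b <;> simp_all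

/-- in a symmetric mutual reinforcement learning equilibrium formed by a
deterministic memory-two strategy and its mirror, for `s1 ∈ {(C,D),(D,C)}` the actions
`τ1(π(s1), s2)` and `τ1(s1, π(s2))` either agree for all `s2` or disagree for all `s2`. -/
theorem stmt_4 (R S T P γ : ℝ) (hTR : T > R) (hRP : R > P) (hPS : P > S)
    (h2R : 2 * R > T + S) (hγ0 : 0 ≤ γ) (hγ1 : γ < 1)
    (τ1 : St → St → Act) (τ2 : St → St → Act)
    (hτ2 : ∀ s1 s2, τ2 s1 s2 = τ1 (pi' s1) (pi' s2))
    (Q1 Q2 : Act → St → St → ℝ)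
    (hQ1 : ∀ σ s1 s2, Q1 σ s1 s2 =
      r1 R S T P σ (τ2 s1 s2) +
        γ * max (Q1 C (σ, τ2 s1 s2) s1) (Q1 D (σ, τ2 s1 s2) s1))
    (hg1 : ∀ s1 s2, (τ1 s1 s2 = C → Q1 C s1 s2 > Q1 D s1 s2) ∧
      (τ1 s1 s2 = D → Q1 D s1 s2 > Q1 C s1 s2))
    (hQ2 : ∀ σ s1 s2, Q2 σ s1 s2 =
      r1 R S T P σ (τ1 s1 s2) +
        γ * max (Q2 C (τ1 s1 s2, σ) s1) (Q2 D (τ1 s1 s2, σ) s1))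
    (hg2 : ∀ s1 s2, (τ2 s1 s2 = C → Q2 C s1 s2 > Q2 D s1 s2) ∧
      (τ2 s1 s2 = D → Q2 D s1 s2 > Q2 C s1 s2)) :
    ∀ s1 : St, s1 = (C, D) ∨ s1 = (D, C) →
      (∀ s2, τ1 (pi' s1) s2 = τ1 s1 (pi' s2)) ∨
      (∀ s2, τ1 (pi' s1) s2 ≠ τ1 s1 (pi' s2)) := by
  intro s1 _
  have key (s a b : St) (h : τ1 (pi' s) (pi' a) = τ1 (pi' s) (pi' b)) : τ1 s a = τ1 s b :=
    greedy_eq_of_opponent_eq hQ1 hg1 (by rw [hτ2, hτ2, h])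
  exact forall_eq_or_forall_ne (fun a b h => key (pi' s1) a b h)
    (fun a b h => key s1 (pi' a) (pi' b) h)
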